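/- Let K_I ∈ ℝ^{n×n} and K_O ∈ ℝ^{m×m} be symmetric with eigendecompositions K_I = U_I Λ_I U_Iᵀ and K_O = U_O Λ_O U_Oᵀ, where U_I, U_O are orthogonal and Λ_I, Λ_O are diagonal. Assume Λ_O (hence K_O) is invertible and that σ² ∈ ℝ is such that H := Λ_I ⊗ I_m + σ² I_n ⊗ Λ_O^{-1} is invertible. Then K := K_I ⊗ K_O + σ² I_{mn} is invertible and K^{-1} = (I_n ⊗ U_O Λ_O^{-1} U_Oᵀ)(U_I ⊗ U_O) H^{-1} (U_Iᵀ ⊗ U_Oᵀ). -/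

import Mathlib

open Matrix
open scoped Kronecker

/-- Inverse of K = K_I ⊗ K_O + σ² I via the eigendecompositions
K_I = U_I Λ_I U_Iᵀ, K_O = U_O Λ_O U_Oᵀ. -/
theorem kronecker_noise_inverse_eigendecomposition {m n : ℕ}
    (KI UI ΛI : Matrix (Fin n) (Fin n) ℝ) (KO UO ΛO : Matrix (Fin m) (Fin m) ℝ)
    (hKI : KI.IsSymm) (hKO : KO.IsSymm)
    (hUI : UIᵀ * UI = 1) (hUO : UOᵀ * UO = 1)
    (hΛI : ΛI.IsDiag) (hΛO : ΛO.IsDiag)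
    (hdecI : KI = UI * ΛI * UIᵀ) (hdecO : KO = UO * ΛO * UOᵀ)
    (hΛOinv : IsUnit ΛO.det) (σ2 : ℝ)
    (H : Matrix (Fin n × Fin m) (Fin n × Fin m) ℝ)
    (hH : H = ΛI ⊗ₖ (1 : Matrix (Fin m) (Fin m) ℝ) +
      σ2 • ((1 : Matrix (Fin n) (Fin n) ℝ) ⊗ₖ ΛO⁻¹))
    (hHinv : IsUnit H.det) :
    IsUnit (KI ⊗ₖ KO + σ2 • (1 : Matrix (Fin n × Fin m) (Fin n × Fin m) ℝ)).det ∧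
      (KI ⊗ₖ KO + σ2 • (1 : Matrix (Fin n × Fin m) (Fin n × Fin m) ℝ))⁻¹ =
        ((1 : Matrix (Fin n) (Fin n) ℝ) ⊗ₖ (UO * ΛO⁻¹ * UOᵀ)) * (UI ⊗ₖ UO) * H⁻¹ *
          (UIᵀ ⊗ₖ UOᵀ) := by
  have hUI2 : UI * UIᵀ = 1 := mul_eq_one_comm.mp hUI
  have hUO2 : UO * UOᵀ = 1 := mul_eq_one_comm.mp hUO
  have hL : ΛO * ΛO⁻¹ = 1 := Matrix.mul_nonsing_inv _ hΛOinv
  have hHH : H * H⁻¹ = 1 := Matrix.mul_nonsing_inv _ hHinv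
  have h1 : UO * ΛO⁻¹ * UOᵀ * UO = UO * ΛO⁻¹ := by
    rw [Matrix.mul_assoc, hUO, Matrix.mul_one]
  have h2 : KI * UI = UI * ΛI := by
    rw [hdecI, Matrix.mul_assoc, hUI, Matrix.mul_one]
  have h3 : KO * (UO * ΛO⁻¹) = UO := by
    rw [hdecO, ← Matrix.mul_assoc, Matrix.mul_assoc (UO * ΛO), hUO, Matrix.mul_one,
      Matrix.mul_assoc, hL, Matrix.mul_one]
  have key : (KI ⊗ₖ KO + σ2 • (1 : Matrix (Fin n × Fin m) (Fin n × Fin m) ℝ)) *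
      (((1 : Matrix (Fin n) (Fin n) ℝ) ⊗ₖ (UO * ΛO⁻¹ * UOᵀ)) * (UI ⊗ₖ UO)) =
      (UI ⊗ₖ UO) * H := by
    rw [← Matrix.mul_kronecker_mul, Matrix.one_mul, h1, Matrix.add_mul,
      ← Matrix.mul_kronecker_mul, h2, h3, hH, Matrix.mul_add, Matrix.smul_mul,
      Matrix.mul_smul, Matrix.one_mul, ← Matrix.mul_kronecker_mul, ← Matrix.mul_kronecker_mul,
      Matrix.mul_one, Matrix.mul_one]
  have main : (KI ⊗ₖ KO + σ2 • (1 : Matrix (Fin n × Fin m) (Fin n × Fin m) ℝ)) *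
      (((1 : Matrix (Fin n) (Fin n) ℝ) ⊗ₖ (UO * ΛO⁻¹ * UOᵀ)) * (UI ⊗ₖ UO) * H⁻¹ *
          (UIᵀ ⊗ₖ UOᵀ)) = 1 := by
    rw [← Matrix.mul_assoc, ← Matrix.mul_assoc, key, Matrix.mul_assoc (UI ⊗ₖ UO), hHH,
      Matrix.mul_one, ← Matrix.mul_kronecker_mul, hUI2, hUO2, Matrix.one_kronecker_one]
  exact ⟨Matrix.isUnit_det_of_right_inverse main, Matrix.inv_eq_right_inv main⟩
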